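/- For every 0 ≤ k ≤ n−1: det′(d_k† ∘ d_k) = ∏_{j=0}^{k} det(Δ_{k−j})^{(−1)^j}. -/

import Mathlib

open LinearMap Module

variable {V : ℕ → Type}

/-- `d_{k-1} ∘ d_{k-1}†`, with the convention `d_{-1} = 0`. -/
noncomputable def ddAdj [∀ k, NormedAddCommGroup (V k)] [∀ k, InnerProductSpace ℂ (V k)]
    [∀ k, FiniteDimensional ℂ (V k)] (d : ∀ k, V k →ₗ[ℂ] V (k + 1)) :
    ∀ k, V k →ₗ[ℂ] V k
  | 0 => 0
  | k + 1 => (d k).comp (LinearMap.adjoint (d k))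

/-- The Laplacian `Δ_k = d_{k-1} ∘ d_{k-1}† + d_k† ∘ d_k` (conventions `d_{-1} = 0`,
and `d_n = 0` is imposed as a hypothesis in the theorems). -/
noncomputable def Lap [∀ k, NormedAddCommGroup (V k)] [∀ k, InnerProductSpace ℂ (V k)]
    [∀ k, FiniteDimensional ℂ (V k)] (d : ∀ k, V k →ₗ[ℂ] V (k + 1)) (k : ℕ) :
    V k →ₗ[ℂ] V k :=
  ddAdj d k + (LinearMap.adjoint (d k)).comp (d k)

open Classical in
/-- `det′ f`: the determinant of the restriction of `f` to `(ker f)ᗮ` (for `f` mapping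
`(ker f)ᗮ` into itself), with `det′ f = 1` when `f = 0`. -/
noncomputable def detPrime {W : Type} [NormedAddCommGroup W] [InnerProductSpace ℂ W]
    [FiniteDimensional ℂ W] (f : W →ₗ[ℂ] W) : ℂ :=
  if h : ∀ x ∈ (LinearMap.ker f)ᗮ, f x ∈ (LinearMap.ker f)ᗮ then
    LinearMap.det (f.restrict h)
  else 1

/-- `range d_{k-1}` as a subspace of `V k`, with the convention `d_{-1} = 0`. -/
noncomputable def rangePrev [∀ k, NormedAddCommGroup (V k)] [∀ k, InnerProductSpace ℂ (V k)]
    [∀ k, FiniteDimensional ℂ (V k)] (d : ∀ k, V k →ₗ[ℂ] V (k + 1)) :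
    ∀ k, Submodule ℂ (V k)
  | 0 => ⊥
  | k + 1 => LinearMap.range (d k)

/-- `ker d_{k-1}†` as a subspace of `V k`, with the convention `d_{-1} = 0`. -/
noncomputable def kerAdjPrev [∀ k, NormedAddCommGroup (V k)] [∀ k, InnerProductSpace ℂ (V k)]
    [∀ k, FiniteDimensional ℂ (V k)] (d : ∀ k, V k →ₗ[ℂ] V (k + 1)) :
    ∀ k, Submodule ℂ (V k)
  | 0 => ⊤
  | k + 1 => LinearMap.ker (LinearMap.adjoint (d k))

theorem LinearMap.det_eq_of_intertwine {R M N : Type*} [CommRing R] [AddCommGroup M] [Module R M]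
    [AddCommGroup N] [Module R N] {f : M →ₗ[R] M} {g : N →ₗ[R] N} (e : M ≃ₗ[R] N)
    (h : ∀ x, g (e x) = e (f x)) : LinearMap.det g = LinearMap.det f := by
  rw [← LinearMap.det_conj f e]
  congr 1
  ext y
  simpa using h (e.symm y)

theorem LinearMap.det_eq_det_restrict_mul_det_restrict {K M : Type*} [Field K] [AddCommGroup M]
    [Module K M] [FiniteDimensional K M] {p q : Submodule K M} (hpq : IsCompl p q)
    {f : M →ₗ[K] M} (hp : ∀ x ∈ p, f x ∈ p) (hq : ∀ x ∈ q, f x ∈ q) :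
    LinearMap.det f = LinearMap.det (f.restrict hp) * LinearMap.det (f.restrict hq) := by
  rw [← LinearMap.det_prodMap]
  refine LinearMap.det_eq_of_intertwine (p.prodEquivOfIsCompl q hpq) fun x => ?_
  simp [Submodule.coe_prodEquivOfIsCompl']

theorem detPrime_eq_det_restrict {W : Type} [NormedAddCommGroup W] [InnerProductSpace ℂ W]
    [FiniteDimensional ℂ W] {f : W →ₗ[ℂ] W} {S : Submodule ℂ W} (hS : (LinearMap.ker f)ᗮ = S)
    (h : ∀ x ∈ S, f x ∈ S) : detPrime f = LinearMap.det (f.restrict h) := by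
  subst hS
  exact dif_pos h

theorem eq_zero_of_mem_orthogonal_ker {E F : Type} [NormedAddCommGroup E] [InnerProductSpace ℂ E]
    [FiniteDimensional ℂ E] [AddCommGroup F] [Module ℂ F] (A : E →ₗ[ℂ] F) {x : E}
    (hx : x ∈ (LinearMap.ker A)ᗮ) (h : A x = 0) : x = 0 :=
  Submodule.disjoint_def.mp (LinearMap.ker A).isCompl_orthogonal.disjoint x h hx

section Adjoint

variable {E F : Type} [NormedAddCommGroup E] [InnerProductSpace ℂ E] [FiniteDimensional ℂ E]
  [NormedAddCommGroup F] [InnerProductSpace ℂ F] [FiniteDimensional ℂ F] (A : E →ₗ[ℂ] F)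

theorem adjoint_mem_orthogonal_ker (y : F) : LinearMap.adjoint A y ∈ (LinearMap.ker A)ᗮ := by
  rw [LinearMap.orthogonal_ker]
  exact ⟨y, rfl⟩

theorem detPrime_adjoint_comp_self :
    detPrime ((LinearMap.adjoint A).comp A) =
      LinearMap.det (((LinearMap.adjoint A).comp A).restrict (p := (LinearMap.ker A)ᗮ)
        (q := (LinearMap.ker A)ᗮ) fun x _ => adjoint_mem_orthogonal_ker A (A x)) :=
  detPrime_eq_det_restrict (by rw [LinearMap.ker_adjoint_comp_self]) _

theorem detPrime_adjoint_comp_self_ne_zero : detPrime ((LinearMap.adjoint A).comp A) ≠ 0 := by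
  rw [detPrime_adjoint_comp_self]
  intro h
  refine (LinearMap.bot_lt_ker_of_det_eq_zero h).ne' ?_
  rw [LinearMap.ker_eq_bot']
  rintro ⟨x, hx⟩ h0
  have h1 : x ∈ LinearMap.ker ((LinearMap.adjoint A).comp A) := congrArg Subtype.val h0
  rw [LinearMap.ker_adjoint_comp_self] at h1
  exact Subtype.ext (eq_zero_of_mem_orthogonal_ker A hx h1)

theorem det_self_comp_adjoint_restrict_range {S : Submodule ℂ F} (hS : S = LinearMap.range A)
    (h : ∀ x ∈ S, A.comp (LinearMap.adjoint A) x ∈ S) :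
    LinearMap.det ((A.comp (LinearMap.adjoint A)).restrict h) =
      detPrime ((LinearMap.adjoint A).comp A) := by
  subst hS
  rw [detPrime_adjoint_comp_self]
  let e : ((LinearMap.ker A)ᗮ : Submodule ℂ E) ≃ₗ[ℂ] LinearMap.range A :=
    LinearEquiv.ofBijective (A.restrict fun x _ => LinearMap.mem_range_self A x) <| by
      constructor
      · rw [← LinearMap.ker_eq_bot, LinearMap.ker_eq_bot']
        exact fun x hx =>
          Subtype.ext (eq_zero_of_mem_orthogonal_ker A x.2 (congrArg Subtype.val hx))
      · rintro ⟨_, x, rfl⟩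
        obtain ⟨y, hy, z, hz, rfl⟩ := (LinearMap.ker A).exists_add_mem_mem_orthogonal x
        exact ⟨⟨z, hz⟩, Subtype.ext (by simp [LinearMap.mem_ker.mp hy])⟩
  exact LinearMap.det_eq_of_intertwine e fun x => rfl

theorem det_add_adjoint_comp_self {T : E →ₗ[ℂ] E}
    (hT : ∀ x ∈ LinearMap.ker A, T x ∈ LinearMap.ker A)
    (hT' : ∀ x ∈ (LinearMap.ker A)ᗮ, T x = 0) :
    LinearMap.det (T + (LinearMap.adjoint A).comp A) =
      LinearMap.det (T.restrict hT) * detPrime ((LinearMap.adjoint A).comp A) := by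
  have hp : ∀ x ∈ LinearMap.ker A, (T + (LinearMap.adjoint A).comp A) x = T x := fun x hx => by
    simp [LinearMap.mem_ker.mp hx]
  have hq : ∀ x ∈ (LinearMap.ker A)ᗮ,
      (T + (LinearMap.adjoint A).comp A) x = (LinearMap.adjoint A).comp A x := fun x hx => by
    simp [hT' x hx]
  rw [detPrime_adjoint_comp_self,
    LinearMap.det_eq_det_restrict_mul_det_restrict (LinearMap.ker A).isCompl_orthogonal
      (fun x hx => hp x hx ▸ hT x hx)
      (fun x hx => hq x hx ▸ adjoint_mem_orthogonal_ker A (A x))]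
  congr 2
  · ext x
    exact hp x x.2
  · ext x
    exact hq x x.2

end Adjoint

section Complex

variable [∀ k, NormedAddCommGroup (V k)] [∀ k, InnerProductSpace ℂ (V k)]
    [∀ k, FiniteDimensional ℂ (V k)] {d : ∀ k, V k →ₗ[ℂ] V (k + 1)}

theorem det_Lap_zero (hker0 : LinearMap.ker (d 0) = ⊥) :
    LinearMap.det (Lap d 0) = detPrime ((LinearMap.adjoint (d 0)).comp (d 0)) := by
  have : Subsingleton (LinearMap.ker (d 0)) := by
    rw [hker0]
    infer_instance
  rw [Lap, det_add_adjoint_comp_self (d 0) (T := ddAdj d 0) (fun _ _ => Submodule.zero_mem _)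
    (fun _ _ => rfl), LinearMap.det_eq_one_of_subsingleton, one_mul]

theorem det_Lap_succ {k : ℕ} (hk : LinearMap.ker (d (k + 1)) = LinearMap.range (d k)) :
    LinearMap.det (Lap d (k + 1)) = detPrime ((LinearMap.adjoint (d k)).comp (d k)) *
      detPrime ((LinearMap.adjoint (d (k + 1))).comp (d (k + 1))) := by
  have hT : ∀ x ∈ LinearMap.ker (d (k + 1)),
      (d k).comp (LinearMap.adjoint (d k)) x ∈ LinearMap.ker (d (k + 1)) := fun x _ => by
    rw [hk]
    exact LinearMap.mem_range_self _ _
  have hT' : ∀ x ∈ (LinearMap.ker (d (k + 1)))ᗮ,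
      (d k).comp (LinearMap.adjoint (d k)) x = 0 := fun x hx => by
    rw [hk, LinearMap.orthogonal_range] at hx
    simp [LinearMap.mem_ker.mp hx]
  rw [← det_self_comp_adjoint_restrict_range (d k) hk hT]
  exact det_add_adjoint_comp_self (d (k + 1)) hT hT'

end Complex

/-- For an acyclic complex of finite-dimensional complex inner product
spaces and every `0 ≤ k ≤ n−1`:
`det′(d_k† ∘ d_k) = ∏_{j=0}^{k} (det Δ_{k−j})^{(−1)^j}`. -/
theorem stmt17 [∀ k, NormedAddCommGroup (V k)] [∀ k, InnerProductSpace ℂ (V k)]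
    [∀ k, FiniteDimensional ℂ (V k)]
    (n : ℕ) (d : ∀ k, V k →ₗ[ℂ] V (k + 1))
    (hcomp : ∀ k, (d (k + 1)).comp (d k) = 0)
    (hzero : ∀ k, n ≤ k → d k = 0)
    (hker0 : LinearMap.ker (d 0) = ⊥)
    (hacyc : ∀ k, k < n → LinearMap.ker (d (k + 1)) = LinearMap.range (d k)) :
    ∀ k < n, detPrime ((LinearMap.adjoint (d k)).comp (d k)) =
      ∏ j ∈ Finset.range (k + 1), LinearMap.det (Lap d (k - j)) ^ ((-1 : ℤ) ^ j) := by
  intro k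
  induction k with
  | zero =>
    intro _
    simp [det_Lap_zero hker0]
  | succ k ih =>
    intro hk
    have hprod : ∏ j ∈ Finset.range (k + 1),
        LinearMap.det (Lap d (k + 1 - (j + 1))) ^ ((-1 : ℤ) ^ (j + 1)) =
        (detPrime ((LinearMap.adjoint (d k)).comp (d k)))⁻¹ := by
      rw [ih (by omega), ← Finset.prod_inv_distrib]
      refine Finset.prod_congr rfl fun j _ => ?_
      rw [Nat.add_sub_add_right, pow_succ, mul_neg_one, zpow_neg]
    rw [Finset.prod_range_succ', hprod, Nat.sub_zero, pow_zero, zpow_one,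
      det_Lap_succ (hacyc k (by omega))]
    field_simp [detPrime_adjoint_comp_self_ne_zero (d k)]
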